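/- arXiv:0905.3611 — 9 statements merged into one kernel-verified Lean document; each statement's English description precedes it below -/
import Mathlib

section
/- If f, g : ℝ → ℝ and K ≥ 0 satisfy |f(x) − f(a) − g(a)(x − a)| ≤ K·(x − a)² for all real x and a, then |g(x) − g(a)| ≤ 2K·|x − a| for all real x and a; that is, the derivative of a uniformly Lipschitz differentiable function is automatically Lipschitz with constant 2K. -/
/-- The derivative of a uniformly Lipschitz differentiable function is automatically
Lipschitz with constant `2K`. -/
theorem ULD_derivative_lipschitz (f g : ℝ → ℝ) (K : ℝ) (hK : 0 ≤ K)
    (huld : ∀ x a : ℝ, |f x - f a - g a * (x - a)| ≤ K * (x - a) ^ 2) :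
    ∀ x a : ℝ, |g x - g a| ≤ 2 * K * |x - a| := by
  intro x a
  rcases eq_or_ne x a with rfl | hxa
  · simp
  have hpos : 0 < |x - a| := abs_pos.mpr (sub_ne_zero.mpr hxa)
  refine le_of_mul_le_mul_right ?_ hpos
  calc |g x - g a| * |x - a|
      = |(f x - f a - g a * (x - a)) + (f a - f x - g x * (a - x))| := by
        rw [← abs_mul]
        congr 1
        ring
    _ ≤ K * (x - a) ^ 2 + K * (a - x) ^ 2 :=
        (abs_add_le _ _).trans (add_le_add (huld x a) (huld a x))
    _ = 2 * K * |x - a| * |x - a| := by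
        rw [mul_assoc, abs_mul_abs_self]
        ring
end

section
/- Let f, g : [A, B] → ℝ (with A ≤ B) and K ≥ 0 satisfy |f(x) − f(a) − g(a)(x − a)| ≤ K·(x − a)² for all x, a ∈ [A, B]. If g(x) ≥ 0 for every x ∈ [A, B], then f(A) ≤ f(B). -/
/-- A function on an interval whose decrease between two points is at most quadratic in their
distance satisfies the same bound with an arbitrarily small constant, by repeated bisection. -/
theorem sub_le_mul_sq_div_two_pow {f : ℝ → ℝ} {s : Set ℝ} (hs : s.OrdConnected) {K : ℝ}
    (h : ∀ x ∈ s, ∀ y ∈ s, x ≤ y → f x - f y ≤ K * (y - x) ^ 2) (n : ℕ) :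
    ∀ x ∈ s, ∀ y ∈ s, x ≤ y → f x - f y ≤ K * (y - x) ^ 2 / 2 ^ n := by
  induction n with
  | zero => simpa using h
  | succ n ih =>
    intro x hx y hy hxy
    have hm : (x + y) / 2 ∈ s := hs.out hx hy ⟨by linarith, by linarith⟩
    have h₁ := ih x hx _ hm (by linarith)
    have h₂ := ih _ hm y hy (by linarith)
    calc f x - f y
        ≤ K * ((x + y) / 2 - x) ^ 2 / 2 ^ n + K * (y - (x + y) / 2) ^ 2 / 2 ^ n := by linarith
      _ = K * (y - x) ^ 2 / 2 ^ (n + 1) := by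
        rw [pow_succ]
        field_simp
        ring

/-- Monotonicity theorem for ULD functions: if `f` is uniformly Lipschitz differentiable on
`[A, B]` with derivative `g` and `g ≥ 0` on `[A, B]`, then `f(A) ≤ f(B)`. -/
theorem ULD_monotonicity (f g : ℝ → ℝ) (A B K : ℝ) (hAB : A ≤ B) (hK : 0 ≤ K)
    (huld : ∀ x ∈ Set.Icc A B, ∀ a ∈ Set.Icc A B,
      |f x - f a - g a * (x - a)| ≤ K * (x - a) ^ 2)
    (hg : ∀ x ∈ Set.Icc A B, 0 ≤ g x) :
    f A ≤ f B := by
  have h : ∀ x ∈ Set.Icc A B, ∀ y ∈ Set.Icc A B, x ≤ y → f x - f y ≤ K * (y - x) ^ 2 := by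
    intro x hx y hy hxy
    have h₁ := (abs_le.1 (huld y hy x hx)).1
    have h₂ := mul_nonneg (hg x hx) (sub_nonneg.2 hxy)
    linarith
  by_contra! hlt
  have hpos : 0 < f A - f B := sub_pos.2 hlt
  obtain ⟨n, hn⟩ := pow_unbounded_of_one_lt (K * (B - A) ^ 2 / (f A - f B)) one_lt_two
  have hle := sub_le_mul_sq_div_two_pow Set.ordConnected_Icc h n A (Set.left_mem_Icc.2 hAB) B
    (Set.right_mem_Icc.2 hAB) hAB
  rw [le_div_iff₀ (by positivity)] at hle
  rw [div_lt_iff₀ hpos] at hn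
  linarith
end

section
/- Let f, g : [A, B] → ℝ (with A ≤ B) and K, M ≥ 0 satisfy |f(x) − f(a) − g(a)(x − a)| ≤ K·(x − a)² for all x, a ∈ [A, B]. If |g(x)| ≤ M for every x ∈ [A, B], then |f(x) − f(a)| ≤ M·|x − a| for all x, a ∈ [A, B]. -/
/-- A quadratic bound on the remainder within `s` gives the derivative within `s`. -/
theorem hasDerivWithinAt_of_abs_sub_le_sq {f : ℝ → ℝ} {f' a K : ℝ} {s : Set ℝ}
    (h : ∀ x ∈ s, |f x - f a - f' * (x - a)| ≤ K * (x - a) ^ 2) :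
    HasDerivWithinAt f f' s a := by
  rw [hasDerivWithinAt_iff_isLittleO]
  refine Asymptotics.IsBigO.trans_isLittleO (g := fun x => ‖x - a‖ ^ 2) ?_
    ((Asymptotics.isLittleO_pow_sub_sub a one_lt_two).mono nhdsWithin_le_nhds)
  refine Asymptotics.IsBigO.of_bound K ?_
  filter_upwards [self_mem_nhdsWithin] with x hx
  simpa [mul_comm] using h x hx

/-- Rule of Bounded Change for ULD functions: if `f` is uniformly Lipschitz differentiable on
`[A, B]` with derivative `g` and `|g| ≤ M` on `[A, B]`, then `|f(x) - f(a)| ≤ M |x - a|` for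
all `x, a ∈ [A, B]`. -/
theorem ULD_rule_of_bounded_change (f g : ℝ → ℝ) (A B K M : ℝ) (hAB : A ≤ B)
    (hK : 0 ≤ K) (hM : 0 ≤ M)
    (huld : ∀ x ∈ Set.Icc A B, ∀ a ∈ Set.Icc A B,
      |f x - f a - g a * (x - a)| ≤ K * (x - a) ^ 2)
    (hg : ∀ x ∈ Set.Icc A B, |g x| ≤ M) :
    ∀ x ∈ Set.Icc A B, ∀ a ∈ Set.Icc A B, |f x - f a| ≤ M * |x - a| := by
  intro x hx a ha
  exact (convex_Icc A B).norm_image_sub_le_of_norm_hasDerivWithin_le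
    (fun y hy => hasDerivWithinAt_of_abs_sub_le_sq fun z hz => huld z hz y hy) hg ha hx
end

section
/- Let f, g : [A, B] → ℝ (with A ≤ B) and K ≥ 0 satisfy |f(x) − f(a) − g(a)(x − a)| ≤ K·(x − a)² for all x, a ∈ [A, B]. Then f is Lipschitz on [A, B]: there exists M ≥ 0 (one may take M = |g(A)| + 2K·(B − A)) such that |f(x) − f(a)| ≤ M·|x − a| for all x, a ∈ [A, B]. -/
/-- The derivative of a ULD function with constant `K` is `2K`-Lipschitz. -/
theorem ULD_deriv_lipschitz {f g : ℝ → ℝ} {s : Set ℝ} {K : ℝ}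
    (huld : ∀ x ∈ s, ∀ a ∈ s, |f x - f a - g a * (x - a)| ≤ K * (x - a) ^ 2)
    {x a : ℝ} (hx : x ∈ s) (ha : a ∈ s) : |g x - g a| ≤ 2 * K * |x - a| := by
  rcases eq_or_ne x a with rfl | hne
  · simp
  have hpos : 0 < |x - a| := abs_pos.mpr (sub_ne_zero.mpr hne)
  refine le_of_mul_le_mul_right ?_ hpos
  calc |g x - g a| * |x - a|
      = |(f x - f a - g a * (x - a)) + (f a - f x - g x * (a - x))| := by
        rw [← abs_mul]; congr 1; ring
    _ ≤ K * (x - a) ^ 2 + K * (a - x) ^ 2 :=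
        (abs_add_le _ _).trans (add_le_add (huld x hx a ha) (huld a ha x hx))
    _ = 2 * K * |x - a| * |x - a| := by
        rw [mul_assoc, abs_mul_abs_self]; ring

/-- A ULD function on `[A, B]` is Lipschitz on `[A, B]`; one may take the Lipschitz constant
`M = |g(A)| + 2K(B - A)`. -/
theorem ULD_is_lipschitz (f g : ℝ → ℝ) (A B K : ℝ) (hAB : A ≤ B) (hK : 0 ≤ K)
    (huld : ∀ x ∈ Set.Icc A B, ∀ a ∈ Set.Icc A B,
      |f x - f a - g a * (x - a)| ≤ K * (x - a) ^ 2) :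
    ∃ M : ℝ, 0 ≤ M ∧ M = |g A| + 2 * K * (B - A) ∧
      ∀ x ∈ Set.Icc A B, ∀ a ∈ Set.Icc A B, |f x - f a| ≤ M * |x - a| := by
  have hBA : 0 ≤ B - A := sub_nonneg.mpr hAB
  refine ⟨_, by positivity, rfl, fun x hx a ha => ?_⟩
  wlog hax : a ≤ x generalizing x a
  · rw [abs_sub_comm (f x), abs_sub_comm x]
    exact this a ha x hx (le_of_not_ge hax)
  have hxa : 0 ≤ x - a := sub_nonneg.mpr hax
  have hga : |g a| ≤ |g A| + 2 * K * (a - A) := by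
    have h := ULD_deriv_lipschitz huld ha (Set.left_mem_Icc.mpr hAB)
    rw [abs_of_nonneg (sub_nonneg.mpr ha.1)] at h
    linarith [abs_sub_abs_le_abs_sub (g a) (g A)]
  rw [abs_of_nonneg hxa]
  calc |f x - f a| = |(f x - f a - g a * (x - a)) + g a * (x - a)| := by
        rw [sub_add_cancel]
    _ ≤ K * (x - a) ^ 2 + |g a| * (x - a) := by
        refine (abs_add_le _ _).trans (add_le_add (huld x hx a ha) ?_)
        rw [abs_mul, abs_of_nonneg hxa]
    _ = (|g a| + K * (x - a)) * (x - a) := by ring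
    _ ≤ (|g A| + 2 * K * (B - A)) * (x - a) := by
        refine mul_le_mul_of_nonneg_right ?_ hxa
        have h : K * (a + x - 2 * A) ≤ K * (2 * (B - A)) :=
          mul_le_mul_of_nonneg_left (by linarith [hx.2]) hK
        linarith
end

section
/- Let m : [0, ∞) → [0, ∞) be increasing with m(0) = 0, and let f, g : ℝ → ℝ and K ≥ 0 satisfy |f(x) − f(a) − g(a)(x − a)| ≤ K·|x − a|·m(|x − a|) for all real x and a. Then |g(x) − g(a)| ≤ 2K·m(|x − a|) for all real x and a; that is, the derivative of a uniformly m-differentiable function is automatically m-continuous with constant 2K. -/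
/-- The derivative of a uniformly `m`-differentiable function is automatically
`m`-continuous with constant `2K`, where `m : [0, ∞) → [0, ∞)` is an increasing modulus
of continuity with `m(0) = 0`. -/
theorem uniform_m_diff_derivative_m_continuous (m : ℝ → ℝ)
    (hm_nonneg : ∀ s : ℝ, 0 ≤ s → 0 ≤ m s)
    (hm_mono : ∀ s t : ℝ, 0 ≤ s → s ≤ t → m s ≤ m t)
    (hm_zero : m 0 = 0)
    (f g : ℝ → ℝ) (K : ℝ) (hK : 0 ≤ K)
    (hdiff : ∀ x a : ℝ, |f x - f a - g a * (x - a)| ≤ K * |x - a| * m |x - a|) :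
    ∀ x a : ℝ, |g x - g a| ≤ 2 * K * m |x - a| := by
  intro x a
  rcases eq_or_ne x a with rfl | hne
  · simp [hm_zero]
  · have hpos : 0 < |x - a| := abs_pos.mpr (sub_ne_zero.mpr hne)
    have hxa := hdiff x a
    have hax := hdiff a x
    rw [abs_sub_comm a x] at hax
    refine le_of_mul_le_mul_right ?_ hpos
    calc |g x - g a| * |x - a|
        = |(f x - f a - g a * (x - a)) + (f a - f x - g x * (a - x))| := by
          rw [← abs_mul]
          congr 1
          ring
      _ ≤ |f x - f a - g a * (x - a)| + |f a - f x - g x * (a - x)| := abs_add_le _ _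
      _ ≤ 2 * K * m |x - a| * |x - a| := by linarith
end

section
/- Let m : [0, ∞) → [0, ∞) be increasing, subadditive, with m(0) = 0, and let f, g : ℝ → ℝ and K ≥ 0 satisfy |f(x) − f(a) − g(a)(x − a)| ≤ K·|x − a|·m(|x − a|) for all real x and a. Define the difference-quotient function Q(x, a) = (f(x) − f(a))/(x − a) for x ≠ a and Q(a, a) = g(a). Then |Q(x, a) − Q(y, a)| ≤ 2K·m(|x − y|) for all real x, y, a. -/
theorem subadditive_modulus_nat_mul_le {m : ℝ → ℝ}
    (hm_subadd : ∀ s t : ℝ, 0 ≤ s → 0 ≤ t → m (s + t) ≤ m s + m t)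
    (hm_zero : m 0 = 0) {h : ℝ} (hh : 0 ≤ h) (n : ℕ) : m (n * h) ≤ n * m h := by
  induction n with
  | zero => simp [hm_zero]
  | succ k ih =>
    have := hm_subadd (k * h) h (by positivity) hh
    push_cast
    rw [add_one_mul, add_one_mul]
    linarith

theorem mul_subadditive_modulus_le {m : ℝ → ℝ}
    (hm_nonneg : ∀ s : ℝ, 0 ≤ s → 0 ≤ m s)
    (hm_mono : ∀ s t : ℝ, 0 ≤ s → s ≤ t → m s ≤ m t)
    (hm_subadd : ∀ s t : ℝ, 0 ≤ s → 0 ≤ t → m (s + t) ≤ m s + m t)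
    (hm_zero : m 0 = 0) {p h : ℝ} (hp : 0 ≤ p) (hh : 0 < h) :
    h * m p ≤ (p + h) * m h := by
  have hceil : (⌈p / h⌉₊ : ℝ) ≤ p / h + 1 := (Nat.ceil_lt_add_one (by positivity)).le
  have hp_le : p ≤ ⌈p / h⌉₊ * h := (div_le_iff₀ hh).1 (Nat.le_ceil _)
  calc h * m p ≤ h * ((p / h + 1) * m h) := by
        refine mul_le_mul_of_nonneg_left ?_ hh.le
        exact ((hm_mono _ _ hp hp_le).trans
          (subadditive_modulus_nat_mul_le hm_subadd hm_zero hh.le _)).trans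
          (mul_le_mul_of_nonneg_right hceil (hm_nonneg h hh.le))
    _ = (p + h) * m h := by field_simp

/-- If `f` is uniformly `m`-differentiable with derivative `g` and constant `K` (where `m` is
an increasing subadditive modulus of continuity with `m(0) = 0`), then its difference quotient
`Q(x, a) = (f(x) - f(a))/(x - a)` (with `Q(a, a) = g(a)`) satisfies
`|Q(x, a) - Q(y, a)| ≤ 2K m(|x - y|)` for all real `x, y, a`. -/
theorem difference_quotient_m_continuous_first_var (m : ℝ → ℝ)
    (hm_nonneg : ∀ s : ℝ, 0 ≤ s → 0 ≤ m s)
    (hm_mono : ∀ s t : ℝ, 0 ≤ s → s ≤ t → m s ≤ m t)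
    (hm_subadd : ∀ s t : ℝ, 0 ≤ s → 0 ≤ t → m (s + t) ≤ m s + m t)
    (hm_zero : m 0 = 0)
    (f g : ℝ → ℝ) (K : ℝ) (hK : 0 ≤ K)
    (hdiff : ∀ x a : ℝ, |f x - f a - g a * (x - a)| ≤ K * |x - a| * m |x - a|)
    (Q : ℝ → ℝ → ℝ)
    (hQ : ∀ x a : ℝ, Q x a = if x = a then g a else (f x - f a) / (x - a)) :
    ∀ x y a : ℝ, |Q x a - Q y a| ≤ 2 * K * m |x - y| := by
  have hQg : ∀ x a, |Q x a - g a| ≤ K * m |x - a| := by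
    intro x a
    rw [hQ]
    split_ifs with hxa
    · simp [hxa, hm_zero]
    · have hne : x - a ≠ 0 := sub_ne_zero.2 hxa
      have hpos : 0 < |x - a| := abs_pos.2 hne
      refine le_of_mul_le_mul_left ?_ hpos
      rw [← abs_mul]
      calc |(x - a) * ((f x - f a) / (x - a) - g a)| = |f x - f a - g a * (x - a)| := by
            congr 1; field_simp
        _ ≤ |x - a| * (K * m |x - a|) := (hdiff x a).trans_eq (by ring)
  have hsymm : ∀ x a, Q x a = Q a x := by
    intro x a
    rw [hQ x a, hQ a x]
    by_cases hxa : x = a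
    · simp [hxa]
    · rw [if_neg hxa, if_neg (Ne.symm hxa), ← neg_sub (f a), ← neg_sub a, neg_div_neg_eq]
  have hmul : ∀ x a, Q x a * (x - a) = f x - f a := by
    intro x a
    rw [hQ]
    split_ifs with hxa
    · simp [hxa]
    · exact div_mul_cancel₀ _ (sub_ne_zero.2 hxa)
  intro x y a
  wlog hle : |x - a| ≤ |y - a| generalizing x y
  · rw [abs_sub_comm (Q x a), abs_sub_comm x]
    exact this y x (le_of_not_ge hle)
  rcases eq_or_ne x y with rfl | hxy
  · simp [hm_zero]
  have hh : 0 < |x - y| := abs_pos.2 (sub_ne_zero.2 hxy)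
  have hxa := hQg x a
  have hya := hQg y a
  have hax := hQg a x
  have hyx := hQg y x
  rw [← hsymm x a, abs_sub_comm a x] at hax
  rw [abs_sub_comm y x] at hyx
  have hsplit : |x - a| + |y - a| = |x - y| ∨ |y - a| = |x - a| + |x - y| := by
    grind
  rcases hsplit with hbetween | houtside
  · have hmx := hm_mono |x - a| |x - y| (abs_nonneg _) (by linarith [abs_nonneg (y - a)])
    have hmy := hm_mono |y - a| |x - y| (abs_nonneg _) (by linarith [abs_nonneg (x - a)])
    have htri := abs_sub_le (Q x a) (g a) (Q y a)
    rw [abs_sub_comm (g a)] at htri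
    have := mul_le_mul_of_nonneg_left hmx hK
    have := mul_le_mul_of_nonneg_left hmy hK
    linarith
  · have hpos : 0 < |y - a| := by linarith [abs_nonneg (x - a)]
    refine le_of_mul_le_mul_left ?_ hpos
    have hident : (y - a) * (Q x a - Q y a) = (x - y) * (Q y x - Q x a) := by
      linear_combination hmul x a - hmul y a + hmul y x
    have htri := abs_sub_le (Q y x) (g x) (Q x a)
    rw [abs_sub_comm (g x)] at htri
    have hmod := mul_subadditive_modulus_le hm_nonneg hm_mono hm_subadd hm_zero
      (abs_nonneg (x - a)) hh
    have hp : 0 ≤ |x - a| * m |x - y| := mul_nonneg (abs_nonneg _) (hm_nonneg _ hh.le)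
    calc |y - a| * |Q x a - Q y a| = |x - y| * |Q y x - Q x a| := by
          rw [← abs_mul, hident, abs_mul]
      _ ≤ |x - y| * (K * m |x - y| + K * m |x - a|) := by
          refine mul_le_mul_of_nonneg_left ?_ hh.le
          linarith
      _ = K * (|x - y| * m |x - y| + |x - y| * m |x - a|) := by ring
      _ ≤ K * (2 * (|x - a| + |x - y|) * m |x - y|) := by
          refine mul_le_mul_of_nonneg_left ?_ hK
          linarith
      _ = |y - a| * (2 * K * m |x - y|) := by rw [houtside]; ring
end

section
/- Let m : [0, ∞) → [0, ∞) be increasing, subadditive, with m(0) = 0, and let f, g : ℝ → ℝ and K ≥ 0 satisfy |f(x) − f(a) − g(a)(x − a)| ≤ K·|x − a|·m(|x − a|) for all real x and a. Define Q(x, a) = (f(x) − f(a))/(x − a) for x ≠ a and Q(a, a) = g(a). Then Q is symmetric, Q(x, a) = Q(a, x), and jointly uniformly m-continuous: |Q(x, a) − Q(y, b)| ≤ 2K·(m(|x − y|) + m(|a − b|)) for all real x, y, a, b. -/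
/-- An increasing subadditive modulus grows at most linearly away from `h`. -/
theorem subadditive_modulus_mul_le {m : ℝ → ℝ}
    (hm_nonneg : ∀ s : ℝ, 0 ≤ s → 0 ≤ m s)
    (hm_mono : ∀ s t : ℝ, 0 ≤ s → s ≤ t → m s ≤ m t)
    (hm_subadd : ∀ s t : ℝ, 0 ≤ s → 0 ≤ t → m (s + t) ≤ m s + m t)
    (hm_zero : m 0 = 0) {h q : ℝ} (hh : 0 < h) (hq : 0 ≤ q) :
    h * m q ≤ (q + h) * m h := by
  have hle : q ≤ ⌈q / h⌉₊ * h := (div_le_iff₀ hh).1 (Nat.le_ceil _)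
  have hlt : (⌈q / h⌉₊ : ℝ) * h ≤ q + h := by
    have := (Nat.ceil_lt_add_one (div_nonneg hq hh.le)).le
    calc (⌈q / h⌉₊ : ℝ) * h ≤ (q / h + 1) * h := by gcongr
      _ = q + h := by field_simp
  calc h * m q ≤ h * (⌈q / h⌉₊ * m h) := by
        gcongr
        exact (hm_mono _ _ hq hle).trans
          (subadditive_modulus_nat_mul_le hm_subadd hm_zero hh.le _)
    _ = ⌈q / h⌉₊ * h * m h := by ring
    _ ≤ (q + h) * m h := mul_le_mul_of_nonneg_right hlt (hm_nonneg h hh.le)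

/-- Of three real points, one of `x`, `y` separates the other from `a`, or `a` is at distance at
most `|x - y|` from both. -/
theorem abs_sub_three_point_cases (x y a : ℝ) :
    |x - a| = |x - y| + |y - a| ∨ |y - a| = |y - x| + |x - a| ∨
      (|x - a| ≤ |x - y| ∧ |y - a| ≤ |x - y|) := by
  rw [abs_sub_comm y x]
  rcases abs_cases (x - a) with ⟨h₁, _⟩ | ⟨h₁, _⟩ <;>
    rcases abs_cases (y - a) with ⟨h₂, _⟩ | ⟨h₂, _⟩ <;>
    rcases abs_cases (x - y) with ⟨h₃, _⟩ | ⟨h₃, _⟩ <;>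
    rw [h₁, h₂, h₃] <;>
    first
    | exact Or.inl (by linarith)
    | exact Or.inr (Or.inl (by linarith))
    | exact Or.inr (Or.inr ⟨by linarith, by linarith⟩)

/-- The difference quotient `Q(x, a) = (f(x) - f(a))/(x - a)` (with `Q(a, a) = g(a)`) of a
uniformly `m`-differentiable function is symmetric, `Q(x, a) = Q(a, x)`, and jointly uniformly
`m`-continuous: `|Q(x, a) - Q(y, b)| ≤ 2K (m(|x - y|) + m(|a - b|))`. -/
theorem difference_quotient_symmetric_and_jointly_m_continuous (m : ℝ → ℝ)
    (hm_nonneg : ∀ s : ℝ, 0 ≤ s → 0 ≤ m s)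
    (hm_mono : ∀ s t : ℝ, 0 ≤ s → s ≤ t → m s ≤ m t)
    (hm_subadd : ∀ s t : ℝ, 0 ≤ s → 0 ≤ t → m (s + t) ≤ m s + m t)
    (hm_zero : m 0 = 0)
    (f g : ℝ → ℝ) (K : ℝ) (hK : 0 ≤ K)
    (hdiff : ∀ x a : ℝ, |f x - f a - g a * (x - a)| ≤ K * |x - a| * m |x - a|)
    (Q : ℝ → ℝ → ℝ)
    (hQ : ∀ x a : ℝ, Q x a = if x = a then g a else (f x - f a) / (x - a)) :
    (∀ x a : ℝ, Q x a = Q a x) ∧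
      ∀ x y a b : ℝ, |Q x a - Q y b| ≤ 2 * K * (m |x - y| + m |a - b|) := by
  have hsymm : ∀ x a : ℝ, Q x a = Q a x := by
    intro x a
    rw [hQ, hQ]
    by_cases h : x = a
    · simp [h]
    · rw [if_neg h, if_neg (Ne.symm h), ← neg_sub (f a), ← neg_sub a, neg_div_neg_eq]
  have hmul : ∀ x a : ℝ, Q x a * (x - a) = f x - f a := by
    intro x a
    rw [hQ]
    split_ifs with h
    · simp [h]
    · exact div_mul_cancel₀ _ (sub_ne_zero.2 h)
  have hnear : ∀ x a : ℝ, |Q x a - g a| ≤ K * m |x - a| := by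
    intro x a
    by_cases h : x = a
    · simp [hQ, h, hm_zero]
    · have hpos : 0 < |x - a| := abs_pos.2 (sub_ne_zero.2 h)
      refine le_of_mul_le_mul_right ?_ hpos
      rw [← abs_mul, sub_mul, hmul]
      linarith [hdiff x a]
  have hnear_two : ∀ x y a : ℝ, |Q x y - Q y a| ≤ K * (m |x - y| + m |y - a|) := by
    intro x y a
    have h₁ := hnear x y
    have h₂ := hnear a y
    rw [hsymm a y, abs_sub_comm a y, abs_sub_comm] at h₂
    linarith [abs_sub_le (Q x y) (g y) (Q y a)]
  have hsame : ∀ x y a : ℝ, |x - a| = |x - y| + |y - a| →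
      |Q x a - Q y a| ≤ 2 * K * m |x - y| := by
    intro x y a hxa
    by_cases hxy : x = y
    · simp [hxy, hm_zero]
    have hpos : 0 < |x - y| := abs_pos.2 (sub_ne_zero.2 hxy)
    have hq : 0 ≤ |y - a| := abs_nonneg _
    have hid : (Q x a - Q y a) * (x - a) = (Q x y - Q y a) * (x - y) := by
      linear_combination hmul x a - hmul x y - hmul y a
    have hgrowth := subadditive_modulus_mul_le hm_nonneg hm_mono hm_subadd hm_zero hpos hq
    have hm := hm_nonneg _ hpos.le
    refine le_of_mul_le_mul_right ?_ (show 0 < |x - a| by linarith)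
    calc |Q x a - Q y a| * |x - a| = |Q x y - Q y a| * |x - y| := by
          rw [← abs_mul, hid, abs_mul]
      _ ≤ K * (m |x - y| + m |y - a|) * |x - y| := by
          gcongr
          exact hnear_two x y a
      _ = K * (|x - y| * m |x - y| + |x - y| * m |y - a|) := by ring
      _ ≤ K * (2 * (|x - y| + |y - a|) * m |x - y|) := by
          gcongr
          linarith [mul_nonneg hq hm]
      _ = 2 * K * m |x - y| * |x - a| := by rw [hxa]; ring
  have hopposite : ∀ x y a : ℝ, |x - a| ≤ |x - y| → |y - a| ≤ |x - y| →
      |Q x a - Q y a| ≤ 2 * K * m |x - y| := by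
    intro x y a hx hy
    have h := hnear_two x a y
    rw [hsymm a y, abs_sub_comm a y] at h
    have h₁ := hm_mono _ _ (abs_nonneg _) hx
    have h₂ := hm_mono _ _ (abs_nonneg _) hy
    calc _ ≤ _ := h
      _ ≤ K * (m |x - y| + m |x - y|) := by gcongr
      _ = _ := by ring
  have hleft : ∀ x y a : ℝ, |Q x a - Q y a| ≤ 2 * K * m |x - y| := by
    intro x y a
    have hcases : |x - a| = |x - y| + |y - a| ∨ |y - a| = |y - x| + |x - a| ∨
        (|x - a| ≤ |x - y| ∧ |y - a| ≤ |x - y|) :=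
      abs_sub_three_point_cases x y a
    rcases hcases with h | h | ⟨hx, hy⟩
    · exact hsame x y a h
    · rw [abs_sub_comm, abs_sub_comm x y]
      exact hsame y x a h
    · exact hopposite x y a hx hy
  refine ⟨hsymm, fun x y a b => ?_⟩
  have h₁ := hleft x y a
  have h₂ := hleft a b y
  rw [hsymm a y, hsymm b y] at h₂
  linarith [abs_sub_le (Q x a) (Q y a) (Q y b)]
end

section
/- Let m : [0, ∞) → [0, ∞) be increasing with m(0) = 0, let f : ℝ → ℝ, and suppose there is a function q : ℝ × ℝ → ℝ and a constant K ≥ 0 such that f(x) − f(a) = (x − a)·q(x, a) for all real x, a, and |q(x, a) − q(y, b)| ≤ K·(m(|x − y|) + m(|a − b|)) for all real x, y, a, b. Then f is uniformly m-differentiable with derivative g(a) = q(a, a): namely |f(x) − f(a) − q(a, a)(x − a)| ≤ K·|x − a|·m(|x − a|) for all real x and a. Thus uniform m-differentiability is equivalent to divisibility of f(x) − f(a) by x − a in the class of uniformly m-continuous functions of two variables. -/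
/-- Converse direction: if `f(x) - f(a) = (x - a) q(x, a)` with `q` jointly uniformly
`m`-continuous with constant `K`, then `f` is uniformly `m`-differentiable with derivative
`g(a) = q(a, a)`: `|f(x) - f(a) - q(a, a)(x - a)| ≤ K |x - a| m(|x - a|)`. -/
theorem factoring_implies_uniform_m_differentiability (m : ℝ → ℝ)
    (hm_nonneg : ∀ s : ℝ, 0 ≤ s → 0 ≤ m s)
    (hm_mono : ∀ s t : ℝ, 0 ≤ s → s ≤ t → m s ≤ m t)
    (hm_zero : m 0 = 0)
    (f : ℝ → ℝ) (q : ℝ × ℝ → ℝ) (K : ℝ) (hK : 0 ≤ K)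
    (hfactor : ∀ x a : ℝ, f x - f a = (x - a) * q (x, a))
    (hq : ∀ x y a b : ℝ, |q (x, a) - q (y, b)| ≤ K * (m |x - y| + m |a - b|)) :
    ∀ x a : ℝ, |f x - f a - q (a, a) * (x - a)| ≤ K * |x - a| * m |x - a| := by
  intro x a
  have h := hq x a a a
  rw [sub_self, abs_zero, hm_zero, add_zero] at h
  calc |f x - f a - q (a, a) * (x - a)|
      = |x - a| * |q (x, a) - q (a, a)| := by
        rw [hfactor, ← abs_mul]
        ring_nf
    _ ≤ |x - a| * (K * m |x - a|) := by gcongr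
    _ = K * |x - a| * m |x - a| := by ring
end

section
/- Let E and F be real normed vector spaces, let m : [0, ∞) → [0, ∞) be increasing and subadditive with m(0) = 0, let f : E → F, let D : E → L(E, F) assign to each point a continuous linear map from E to F, and let K ≥ 0. If ‖f(x + h) − f(x) − D(x)h‖ ≤ K·‖h‖·m(‖h‖) for all x, h ∈ E, then ‖D(x + h) − D(x)‖ ≤ 6K·m(‖h‖) for all x, h ∈ E, where the left-hand side is the operator norm; that is, a uniform derivative is automatically uniformly continuous with the same modulus of continuity (up to the constant factor 6). -/
/-- In normed spaces, a uniform `m`-derivative is automatically uniformly `m`-continuous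
(in operator norm) with constant `6K`: if
`‖f(x + h) - f(x) - D(x) h‖ ≤ K ‖h‖ m(‖h‖)` for all `x, h`, then
`‖D(x + h) - D(x)‖ ≤ 6 K m(‖h‖)` for all `x, h`. -/
theorem uniform_derivative_uniformly_continuous
    {E F : Type*} [NormedAddCommGroup E] [NormedSpace ℝ E]
    [NormedAddCommGroup F] [NormedSpace ℝ F]
    (m : ℝ → ℝ)
    (hm_nonneg : ∀ s : ℝ, 0 ≤ s → 0 ≤ m s)
    (hm_mono : ∀ s t : ℝ, 0 ≤ s → s ≤ t → m s ≤ m t)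
    (hm_subadd : ∀ s t : ℝ, 0 ≤ s → 0 ≤ t → m (s + t) ≤ m s + m t)
    (hm_zero : m 0 = 0)
    (f : E → F) (D : E → (E →L[ℝ] F)) (K : ℝ) (hK : 0 ≤ K)
    (hdiff : ∀ x h : E, ‖f (x + h) - f x - D x h‖ ≤ K * ‖h‖ * m ‖h‖) :
    ∀ x h : E, ‖D (x + h) - D x‖ ≤ 6 * K * m ‖h‖ := by
  intro x h
  obtain rfl | hh := eq_or_ne h 0
  · simp [hm_zero]
  have hpos : 0 < ‖h‖ := norm_pos_iff.mpr hh
  have hM : 0 ≤ m ‖h‖ := hm_nonneg _ hpos.le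
  refine ContinuousLinearMap.opNorm_le_of_unit_norm (𝕜 := ℝ) (by positivity) fun u hu => ?_
  set k : E := ‖h‖ • u with hk
  have hk_norm : ‖k‖ = ‖h‖ := by rw [hk, norm_smul, hu, norm_norm, mul_one]
  have h₁ := hdiff (x + h) k
  have h₂ := hdiff x (h + k)
  have h₃ := hdiff x h
  rw [hk_norm] at h₁
  have hsum : ‖h + k‖ ≤ ‖h‖ + ‖h‖ := (norm_add_le h k).trans_eq (by rw [hk_norm])
  have hm_sum : m ‖h + k‖ ≤ m ‖h‖ + m ‖h‖ :=
    (hm_mono _ _ (norm_nonneg _) hsum).trans (hm_subadd _ _ hpos.le hpos.le)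
  have h₂' : K * ‖h + k‖ * m ‖h + k‖ ≤ K * (‖h‖ + ‖h‖) * (m ‖h‖ + m ‖h‖) :=
    mul_le_mul (mul_le_mul_of_nonneg_left hsum hK) hm_sum
      (hm_nonneg _ (norm_nonneg _)) (by positivity)
  have hsplit : (D (x + h) - D x) k =
      (f (x + (h + k)) - f x - D x (h + k)) - (f (x + h + k) - f (x + h) - D (x + h) k)
        - (f (x + h) - f x - D x h) := by
    rw [sub_apply, map_add, add_assoc]
    abel
  have hbound : ‖(D (x + h) - D x) k‖ ≤ ‖h‖ * (6 * K * m ‖h‖) := by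
    rw [hsplit]
    refine (norm_sub_le _ _).trans ?_
    refine (add_le_add_left (norm_sub_le _ _) _).trans ?_
    linarith
  rw [hk, map_smul, norm_smul, norm_norm] at hbound
  exact le_of_mul_le_mul_left hbound hpos
end
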